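/- There exists N such that for every odd integer k > 5 and every integer n ≥ N with n ≡ 4 (mod 7), the number of isomorphism classes of cyclic (K_{2nk+1}, C_k)-designs satisfies NC(2nk+1, k) ≥ 3.35^n / k. -/

import Mathlib

namespace CCS

/-- A block: a set of edges of the complete graph on `ZMod v`. -/
abbrev Block (v : ℕ) := Finset (Sym2 (ZMod v))

/-- The edge set of the closed tuple `c = (c 0, c 1, …, c (k-1))`. -/
def edgesOf {v k : ℕ} (c : Fin k → ZMod v) : Block v :=
  Finset.image (fun i : Fin k => s(c i, c ⟨(i.1 + 1) % k, Nat.mod_lt _ i.pos⟩)) Finset.univ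

/-- `E` is the edge set of a `k`-cycle on `ZMod v`. Since for `k ≥ 3` the edge set
determines the closed tuple up to rotation and reversal, a `k`-cycle is identified
with its edge set. -/
def IsCycleBlock (v k : ℕ) (E : Block v) : Prop :=
  ∃ c : Fin k → ZMod v, Function.Injective c ∧ E = edgesOf c

/-- The translate `E + z` of a cycle. -/
def translateBlock {v : ℕ} (E : Block v) (z : ZMod v) : Block v :=
  E.image (Sym2.map (· + z))

/-- A `(K_v, C_k)`-design: a set of `k`-cycles whose edge sets partition the edges of `K_v`. -/
def IsDesign (v k : ℕ) (B : Set (Block v)) : Prop :=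
  (∀ E ∈ B, IsCycleBlock v k E) ∧
  ∀ e : Sym2 (ZMod v), ¬ e.IsDiag → ∃! E, E ∈ B ∧ e ∈ E

/-- A cyclic `(K_v, C_k)`-design. -/
def IsCyclicDesign (v k : ℕ) (B : Set (Block v)) : Prop :=
  IsDesign v k B ∧ ∀ E ∈ B, ∀ z : ZMod v, translateBlock E z ∈ B

/-- Two designs are isomorphic if a bijection of `ZMod v` maps one onto the other. -/
def Isomorphic {v : ℕ} (B B' : Set (Block v)) : Prop :=
  ∃ f : ZMod v ≃ ZMod v, B' = (fun E : Block v => E.image (Sym2.map f)) '' B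

/-- `NC v k`: the number of cyclic `(K_v, C_k)`-designs up to isomorphism. -/
noncomputable def NC (v k : ℕ) : ℕ :=
  Nat.card (Quot fun B B' : {B : Set (Block v) // IsCyclicDesign v k B} =>
    Isomorphic B.1 B'.1)

/-- The type of a cycle: the order of its stabilizer under translations. -/
noncomputable def cycleType {v : ℕ} (E : Block v) : ℕ :=
  Nat.card {z : ZMod v // translateBlock E z = E}

/-- The two differences `±(a-b)` arising from an edge `{a,b}`. -/
def edgeDiffs {v : ℕ} : Sym2 (ZMod v) → Multiset (ZMod v) :=
  Sym2.lift ⟨fun a b => {a - b, b - a}, fun a b => by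
    show (a-b) ::ₘ {b-a} = (b-a) ::ₘ {a-b}; exact Multiset.cons_swap _ _ _⟩

/-- The multiset of the `2k` differences arising from the `k` edges of a cycle.
For a cycle of type `d` this is `d` copies of the list `∂C` of partial differences. -/
def fullDiffs {v : ℕ} (E : Block v) : Multiset (ZMod v) :=
  E.val.bind edgeDiffs

/-- The multiset `∂C` of partial differences of a cycle: each difference is counted
with multiplicity equal to its multiplicity among the `2k` edge differences divided
by the type of the cycle. -/
noncomputable def partialDiffs {v : ℕ} (E : Block v) : Multiset (ZMod v) :=
  (fullDiffs E).toFinset.val.bind fun x =>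
    Multiset.replicate ((fullDiffs E).count x / cycleType E) x

/-- A `(K_v, C_k)`-difference system: a set of `k`-cycles whose partial differences
cover every nonzero element of `ZMod v` exactly once. -/
def IsDifferenceSystem (v k : ℕ) (F : Finset (Block v)) : Prop :=
  (∀ E ∈ F, IsCycleBlock v k E) ∧
  ∀ x : ZMod v, (F.val.bind partialDiffs).count x = if x = 0 then 0 else 1

end CCS

namespace CCS

/-- The image of a set of blocks under a permutation of the points. -/
def permBlocks {v : ℕ} (f : Equiv.Perm (ZMod v)) (B : Set (Block v)) : Set (Block v) :=
  (fun E : Block v => E.image (Sym2.map f)) '' B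

lemma permBlocks_mul {v : ℕ} (f g : Equiv.Perm (ZMod v)) (B : Set (Block v)) :
    permBlocks (f * g) B = permBlocks f (permBlocks g B) := by
  simp only [permBlocks, Set.image_image, Finset.image_image, Sym2.map_comp, Equiv.Perm.coe_mul]

lemma permBlocks_one {v : ℕ} (B : Set (Block v)) : permBlocks 1 B = B := by
  simp [permBlocks, Sym2.map_id]

lemma permBlocks_inv {v : ℕ} {f : Equiv.Perm (ZMod v)} {B B' : Set (Block v)}
    (h : B' = permBlocks f B) : B = permBlocks f⁻¹ B' := by
  rw [h, ← permBlocks_mul, inv_mul_cancel, permBlocks_one]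

lemma translateBlock_translateBlock {v : ℕ} (E : Block v) (y z : ZMod v) :
    translateBlock (translateBlock E y) z = translateBlock E (y + z) := by
  simp only [translateBlock, Finset.image_image, ← Sym2.map_comp]
  congr 2
  funext x
  simp [add_assoc]

lemma translateBlock_zero {v : ℕ} (E : Block v) : translateBlock E 0 = E := by
  simp [translateBlock, Sym2.map_id']

lemma permBlocks_translation {v k : ℕ} {B : Set (Block v)} (hB : IsCyclicDesign v k B) :
    permBlocks (Equiv.addRight 1) B = B := by
  ext E
  constructor
  · rintro ⟨E', hE', rfl⟩
    exact hB.2 E' hE' 1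
  · intro hE
    refine ⟨translateBlock E (-1), hB.2 E hE (-1), ?_⟩
    change translateBlock (translateBlock E (-1)) 1 = E
    rw [translateBlock_translateBlock, neg_add_cancel, translateBlock_zero]

lemma isomorphic_equivalence {v k : ℕ} :
    Equivalence fun B B' : {B : Set (Block v) // IsCyclicDesign v k B} =>
      Isomorphic B.1 B'.1 where
  refl B := ⟨1, (permBlocks_one _).symm⟩
  symm := fun ⟨f, hf⟩ => ⟨f⁻¹, permBlocks_inv hf⟩
  trans := fun ⟨f, hf⟩ ⟨g, hg⟩ => ⟨g * f, by
    rw [hg, hf]; exact (permBlocks_mul g f _).symm⟩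

/-- A permutation conjugating a given permutation to the translation by `1` is determined
by the image of a single point. -/
lemma eq_of_conj_translation_eq {v : ℕ} [NeZero v] {f g : Equiv.Perm (ZMod v)}
    (h : f⁻¹ * Equiv.addRight 1 * f = g⁻¹ * Equiv.addRight 1 * g) (h0 : f 0 = g 0) : f = g := by
  have step : ∀ (f : Equiv.Perm (ZMod v)) (n : ℕ),
      f (((f⁻¹ * Equiv.addRight 1 * f : Equiv.Perm (ZMod v)) ^ n) 0) = f 0 + n := by
    intro f n
    induction n with
    | zero => simp
    | succ n ih =>
      rw [pow_succ']
      change f (f.symm (f (((f⁻¹ * Equiv.addRight 1 * f : Equiv.Perm (ZMod v)) ^ n) 0) + 1)) = _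
      rw [Equiv.apply_symm_apply, ih]
      push_cast
      ring
  ext1 x
  have hf := step f (f x - f 0).val
  have hg := step g (f x - f 0).val
  rw [ZMod.natCast_zmod_val, add_sub_cancel] at hf
  rw [ZMod.natCast_zmod_val, ← h, f.injective hf, ← h0, add_sub_cancel] at hg
  exact hg.symm

/-- An isomorphism class contains at most `v` cyclic designs. -/
lemma card_isomorphic_le {v k : ℕ} [NeZero v] (B : Set (Block v)) :
    Nat.card {B' : {B' : Set (Block v) // IsCyclicDesign v k B'} // Isomorphic B B'.1} ≤ v := by
  classical
  let G := {f : Equiv.Perm (ZMod v) // permBlocks f B = B}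
  let F := {B' : {B' : Set (Block v) // IsCyclicDesign v k B'} // Isomorphic B B'.1}
  choose φ hφ using fun b : F => b.2
  have hφ' : ∀ (b : F) (a : G), permBlocks (φ b * a.1) B = b.1.1 := fun b a => by
    rw [permBlocks_mul, a.2]; exact (hφ b).symm
  let Ψ : F × G → ZMod v × G := fun x =>
    (φ x.1 (x.2.1 0), ⟨(φ x.1 * x.2.1)⁻¹ * Equiv.addRight 1 * (φ x.1 * x.2.1), by
      rw [permBlocks_mul, permBlocks_mul, hφ', permBlocks_translation x.1.1.2]
      exact (permBlocks_inv (hφ' x.1 x.2).symm).symm⟩)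
  have hΨ : Function.Injective Ψ := by
    rintro ⟨b, a⟩ ⟨b', a'⟩ h
    obtain ⟨h0, h1⟩ := Prod.mk.inj h
    have hfg := eq_of_conj_translation_eq (Subtype.mk.inj h1) h0
    have hb : b = b' := Subtype.ext (Subtype.ext (by rw [← hφ' b a, ← hφ' b' a', hfg]))
    subst hb
    exact Prod.ext rfl (Subtype.ext (mul_left_cancel hfg))
  have hcard := Nat.card_le_card_of_injective Ψ hΨ
  rw [Nat.card_prod, Nat.card_prod, Nat.card_zmod] at hcard
  have : Nonempty G := ⟨⟨1, permBlocks_one B⟩⟩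
  exact Nat.le_of_mul_le_mul_right hcard Nat.card_pos

/-- Up to isomorphism, the number of cyclic designs drops at most by the factor `v`. -/
lemma card_cyclicDesign_le (v k : ℕ) [NeZero v] :
    Nat.card {B : Set (Block v) // IsCyclicDesign v k B} ≤ v * NC v k := by
  classical
  let X := {B : Set (Block v) // IsCyclicDesign v k B}
  let q : X → Quot fun B B' : X => Isomorphic B.1 B'.1 := Quot.mk _
  have : Fintype X := Fintype.ofFinite _
  have : Fintype (Quot fun B B' : X => Isomorphic B.1 B'.1) := Fintype.ofFinite _
  rw [NC, Nat.card_eq_fintype_card, Nat.card_eq_fintype_card, ← Finset.card_univ,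
    ← Finset.card_univ]
  refine Finset.card_le_mul_card_image_of_maps_to (f := q) (fun _ _ => Finset.mem_univ _) v ?_
  intro y _
  induction y using Quot.ind with
  | mk B =>
    refine le_trans (le_of_eq ?_) (card_isomorphic_le (k := k) B.1)
    rw [Nat.card_eq_fintype_card, Fintype.card_subtype]
    congr 1
    ext B'
    simp only [Finset.mem_filter, Finset.mem_univ, true_and]
    exact ⟨fun h => (isomorphic_equivalence.eqvGen_iff).1 (Quot.eqvGen_exact h.symm),
      fun h => (Quot.sound (r := fun B B' : X => Isomorphic B.1 B'.1) h).symm⟩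

end CCS

namespace CCS

/-- The cyclic successor of an index. -/
def nextIdx {k : ℕ} (u : Fin k) : Fin k := ⟨(u.1 + 1) % k, Nat.mod_lt _ u.pos⟩

/-- The `u`-th edge of the closed tuple `c`. -/
def edgeAt {v k : ℕ} (c : Fin k → ZMod v) (u : Fin k) : Sym2 (ZMod v) := s(c u, c (nextIdx u))

/-- The difference of the `u`-th edge of the closed tuple `c`. -/
def diffAt {v k : ℕ} (c : Fin k → ZMod v) (u : Fin k) : ZMod v := c (nextIdx u) - c u

lemma mem_edgesOf {v k : ℕ} {c : Fin k → ZMod v} {e : Sym2 (ZMod v)} :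
    e ∈ edgesOf c ↔ ∃ u, edgeAt c u = e := by
  simp [edgesOf, edgeAt, nextIdx]

lemma mem_translateBlock_edgesOf {v k : ℕ} {c : Fin k → ZMod v} {z : ZMod v}
    {e : Sym2 (ZMod v)} :
    e ∈ translateBlock (edgesOf c) z ↔ ∃ u, s(c u + z, c (nextIdx u) + z) = e := by
  simp [translateBlock, mem_edgesOf, edgeAt]

lemma translateBlock_edgesOf {v k : ℕ} (c : Fin k → ZMod v) (z : ZMod v) :
    translateBlock (edgesOf c) z = edgesOf fun u => c u + z := by
  ext e
  rw [mem_translateBlock_edgesOf, mem_edgesOf]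
  rfl

/-- A family of `n` closed `k`-tuples without repeated vertices whose edge differences cover,
up to sign, all nonzero elements. -/
structure IsBaseFamily {v n k : ℕ} (C : Fin n → Fin k → ZMod v) : Prop where
  inj : ∀ i, Function.Injective (C i)
  cover : ∀ d : ZMod v, d ≠ 0 → ∃ i u, diffAt (C i) u = d ∨ diffAt (C i) u = -d

/-- The set of all translates of the cycles of a family. -/
def development {v n k : ℕ} (C : Fin n → Fin k → ZMod v) : Set (Block v) :=
  {E | ∃ i z, E = translateBlock (edgesOf (C i)) z}

lemma sub_eq_or_neg_of_sym2_eq {v : ℕ} {a b c d : ZMod v} (h : s(a, b) = s(c, d)) :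
    b - a = d - c ∨ b - a = -(d - c) := by
  rcases Sym2.eq_iff.1 h with ⟨rfl, rfl⟩ | ⟨rfl, rfl⟩
  · exact Or.inl rfl
  · exact Or.inr (by ring)

lemma eq_zero_of_add_self {v : ℕ} (hv : Odd v) {z : ZMod v} (h : z + z = 0) : z = 0 := by
  have h2 : IsUnit ((2 : ℕ) : ZMod v) :=
    (ZMod.isUnit_iff_coprime 2 v).2 (Nat.coprime_two_left.2 hv)
  refine h2.mul_left_cancel ?_
  push_cast
  rw [two_mul, h, mul_zero]

/-- In odd order, a nondegenerate edge is fixed by no nonzero translation. -/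
lemma eq_of_translated_edge_eq {v : ℕ} (hv : Odd v) {a b y z : ZMod v} (hab : a ≠ b)
    (h : s(a + y, b + y) = s(a + z, b + z)) : y = z := by
  rcases Sym2.eq_iff.1 h with ⟨h1, -⟩ | ⟨h1, h2⟩
  · exact add_left_cancel h1
  · exact absurd (sub_eq_zero.1 (eq_zero_of_add_self hv
      (show (a - b) + (a - b) = 0 by linear_combination h1 - h2))) hab

namespace IsBaseFamily

variable {v n k : ℕ} {C C' : Fin n → Fin k → ZMod v}

/-- Since there are only `2nk` nonzero elements, every difference occurs exactly once. -/
lemma index_unique (hC : IsBaseFamily C) (hv : v = 2 * n * k + 1) {i i' : Fin n} {u u' : Fin k}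
    (h : diffAt (C i) u = diffAt (C i') u' ∨ diffAt (C i) u = -diffAt (C i') u') :
    i = i' ∧ u = u' := by
  have : NeZero v := ⟨by omega⟩
  let f : Bool × Fin n × Fin k → ZMod v := fun x =>
    if x.1 then diffAt (C x.2.1) x.2.2 else -diffAt (C x.2.1) x.2.2
  have himg : Finset.univ.erase (0 : ZMod v) ⊆ Finset.univ.image f := by
    intro d hd
    obtain ⟨i, u, h | h⟩ := hC.cover d (Finset.ne_of_mem_erase hd)
    · exact Finset.mem_image.2 ⟨(true, i, u), Finset.mem_univ _, by simpa [f] using h⟩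
    · exact Finset.mem_image.2 ⟨(false, i, u), Finset.mem_univ _, by simp [f, h]⟩
  have hcard : (Finset.univ.image f).card = (Finset.univ : Finset (Bool × Fin n × Fin k)).card := by
    refine le_antisymm Finset.card_image_le ?_
    refine le_trans (le_of_eq ?_) (Finset.card_le_card himg)
    rw [Finset.card_erase_of_mem (Finset.mem_univ _), Finset.card_univ, Finset.card_univ,
      ZMod.card, hv]
    simp [mul_assoc]
  have hinj : Function.Injective f := by
    simpa using Finset.card_image_iff.1 hcard
  rcases h with h | h
  · have := @hinj (true, i, u) (true, i', u') (by simpa [f] using h)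
    simpa using this
  · have := @hinj (true, i, u) (false, i', u') (by simpa [f] using h)
    simp at this

lemma isCyclicDesign (hC : IsBaseFamily C) (hv : v = 2 * n * k + 1) :
    IsCyclicDesign v k (development C) := by
  have hodd : Odd v := ⟨n * k, by rw [hv]; ring⟩
  refine ⟨⟨?_, ?_⟩, ?_⟩
  · rintro E ⟨i, z, rfl⟩
    exact ⟨fun u => C i u + z, fun a b h => hC.inj i (add_right_cancel h),
      translateBlock_edgesOf _ _⟩
  · intro e
    induction e using Sym2.ind with
    | _ a b =>
    intro hab
    rw [Sym2.mk_isDiag_iff] at hab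
    have hex : ∃ i u z, s(C i u + z, C i (nextIdx u) + z) = s(a, b) := by
      obtain ⟨i, u, h | h⟩ := hC.cover (b - a) (sub_ne_zero.2 (Ne.symm hab))
      · refine ⟨i, u, a - C i u, ?_⟩
        rw [diffAt] at h
        rw [show C i u + (a - C i u) = a by ring,
          show C i (nextIdx u) + (a - C i u) = b by linear_combination h]
      · refine ⟨i, u, b - C i u, ?_⟩
        rw [diffAt] at h
        rw [show C i u + (b - C i u) = b by ring,
          show C i (nextIdx u) + (b - C i u) = a by linear_combination h, Sym2.eq_swap]
    obtain ⟨i, u, z, hz⟩ := hex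
    refine ⟨_, ⟨⟨i, z, rfl⟩, mem_translateBlock_edgesOf.2 ⟨u, hz⟩⟩, ?_⟩
    rintro _ ⟨⟨i', z', rfl⟩, he⟩
    obtain ⟨u', hu'⟩ := mem_translateBlock_edgesOf.1 he
    have key := sub_eq_or_neg_of_sym2_eq (hz.trans hu'.symm)
    simp only [add_sub_add_right_eq_sub] at key
    obtain ⟨rfl, rfl⟩ := hC.index_unique hv key
    have hne : C i u ≠ C i (nextIdx u) := fun h0 => by
      rw [h0] at hz
      have : (s(a, b)).IsDiag := by rw [← hz]; simp
      exact hab (Sym2.mk_isDiag_iff.1 this)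
    rw [eq_of_translated_edge_eq hodd hne (hz.trans hu'.symm)]
  · rintro E ⟨i, y, rfl⟩ z
    exact ⟨i, y + z, translateBlock_translateBlock _ _ _⟩

/-- Two base families with the same development and one common edge in their `i`-th cycles have
the same `i`-th cycle. -/
lemma edgesOf_eq_of_development_eq (hC' : IsBaseFamily C')
    (hv : v = 2 * n * k + 1) (h : development C = development C') {i : Fin n} {u : Fin k}
    (h0 : C i u = C' i u) (h1 : C i (nextIdx u) = C' i (nextIdx u))
    (hne : C i u ≠ C i (nextIdx u)) : edgesOf (C i) = edgesOf (C' i) := by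
  have hodd : Odd v := ⟨n * k, by rw [hv]; ring⟩
  have hmem : edgesOf (C i) ∈ development C' := by
    rw [← h]
    exact ⟨i, 0, (translateBlock_zero _).symm⟩
  obtain ⟨i', z, hz⟩ := hmem
  have he : edgeAt (C i) u ∈ translateBlock (edgesOf (C' i')) z := by
    rw [← hz]
    exact mem_edgesOf.2 ⟨u, rfl⟩
  obtain ⟨u', hu'⟩ := mem_translateBlock_edgesOf.1 he
  rw [edgeAt, h0, h1] at hu'
  have key := sub_eq_or_neg_of_sym2_eq hu'
  simp only [add_sub_add_right_eq_sub] at key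
  obtain ⟨rfl, rfl⟩ := hC'.index_unique hv key
  rw [h0, h1] at hne
  have hz0 : z = 0 := eq_of_translated_edge_eq hodd hne (by simpa using hu')
  rw [hz, hz0, translateBlock_zero]

/-- Equal cycles have the same edge with a given difference. -/
lemma edgeAt_eq_of_edgesOf_eq (hC' : IsBaseFamily C')
    (hv : v = 2 * n * k + 1) {i : Fin n} (h : edgesOf (C i) = edgesOf (C' i)) {u u' : Fin k}
    (hd : diffAt (C i) u = diffAt (C' i) u' ∨ diffAt (C i) u = -diffAt (C' i) u') :
    edgeAt (C i) u = edgeAt (C' i) u' := by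
  have he : edgeAt (C i) u ∈ edgesOf (C' i) := h ▸ mem_edgesOf.2 ⟨u, rfl⟩
  obtain ⟨w, hw⟩ := mem_edgesOf.1 he
  have key : diffAt (C' i) w = diffAt (C i) u ∨ diffAt (C' i) w = -diffAt (C i) u :=
    sub_eq_or_neg_of_sym2_eq hw
  have : w = u' := (hC'.index_unique hv (i := i) (i' := i) (by
    rcases key with k1 | k1 <;> rcases hd with k2 | k2 <;> simp [k1, k2])).2
  rw [← hw, this]

end IsBaseFamily

end CCS

namespace CCS

/-- The largest length `nk` of an edge of `K_{2nk+1}`, where `k = 2m+3`. -/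
def maxLen (n m : ℕ) : ℕ := 2 * (m * n) + 3 * n

/-- The length in the interval `[m+n+1, m+3n+1]` that lies in no zero-sum triple. -/
def hole (n m : ℕ) : ℕ := m + 2 * n + (n + 1) / 2 + 1

/-- The smaller length of the pair containing the hole. -/
def holeLo (n m : ℕ) : ℕ := if m % 2 = 0 then hole n m else m

/-- The larger length of the pair containing the hole. -/
def holeHi (n m : ℕ) : ℕ := if m % 2 = 0 then m + 3 * n + 2 else hole n m

/-- The least length above all those used in the triples and in the pair of the hole. -/
def tailStart (n m : ℕ) : ℕ := m + 3 * n + 3 - m % 2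

/-- The representative `nk` or `nk + 1` of the largest length, chosen to fit the parity. -/
def apex (n m : ℕ) : ℕ :=
  maxLen n m + (maxLen n m + (holeHi n m - holeLo n m) + tailStart n m) % 2

/-- The length compensating `apex` and the pair of the hole. -/
def mate (n m : ℕ) : ℕ := apex n m - (holeHi n m - holeLo n m) + 2

/-- The smaller element of the `t`-th pair of consecutive lengths outside the triples. -/
def pairStart (n m t : ℕ) : ℕ :=
  if t < m / 2 then 2 * t + 1
  else if t < m / 2 + (mate n m - tailStart n m) / 2 then tailStart n m + 2 * (t - m / 2)
  else mate n m + 1 + 2 * (t - m / 2 - (mate n m - tailStart n m) / 2)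

/-- The smaller element of the `j`-th pair of the `i`-th cycle. -/
def pairOf (n m i j : ℕ) : ℕ :=
  pairStart n m (if i = 0 then m - 1 - j else i * m + m - 3 - j)

/-- The middle length of the triple `(m + i + 1, legB, legB + i + 1)` of the `i`-th cycle. -/
def legB (n m i : ℕ) : ℕ :=
  (if (i + 1) % 2 = 0 then hole n m else m + n + (n + 1) / 2 + 1) - (i + 2) / 2

/-- The `u`-th vertex of the `i`-th base cycle. The sign `s i j` tells whether the `j`-th pair is
traversed on the positive side. -/
def vertex (n m : ℕ) (s : ℕ → ℕ → Bool) (i u : ℕ) : ℤ :=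
  if u = 2 * m + 3 then 0
  else if u = 2 * m + 2 then -(legB n m i + i + 1)
  else if u = 2 * m + 1 then -(i + 1)
  else if i = 0 ∧ u = 1 then -apex n m
  else if i = 0 ∧ u = 2 then -apex n m + holeHi n m
  else if i = 0 ∧ u = 3 then -apex n m + holeHi n m - holeLo n m
  else if u % 2 = 0 then (u / 2 : ℕ)
  else if s i (u / 2) then (u / 2 : ℕ) + pairOf n m i (u / 2) + 1
  else (u / 2 : ℕ) - pairOf n m i (u / 2)

section Construction

variable {n m : ℕ}

lemma mul_bounds (hn : 12 ≤ n) (hm : 2 ≤ m) :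
    2 * n ≤ m * n ∧ 12 * m ≤ m * n ∧ (m % 2 = 0 ∨ 3 * n ≤ m * n) := by
  refine ⟨Nat.mul_le_mul_right n hm, by rw [mul_comm]; exact Nat.mul_le_mul_left m hn, ?_⟩
  rcases Nat.mod_two_eq_zero_or_one m with h | h
  · exact Or.inl h
  · exact Or.inr (Nat.mul_le_mul_right n (by omega))

lemma mate_spec (hn : 12 ≤ n) (hm : 2 ≤ m) :
    tailStart n m ≤ mate n m ∧ mate n m < maxLen n m ∧
    (mate n m - tailStart n m) % 2 = 0 ∧
    (apex n m = maxLen n m ∨ apex n m = maxLen n m + 1) ∧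
    mate n m + holeHi n m = apex n m + 2 + holeLo n m ∧
    0 < holeLo n m ∧ holeLo n m + 3 < holeHi n m := by
  obtain ⟨h1, h2, h3⟩ := mul_bounds hn hm
  simp only [mate, apex, tailStart, holeHi, holeLo, hole, maxLen]
  generalize m * n = q at *
  split_ifs <;> refine ⟨?_, ?_, ?_, ?_, ?_, ?_, ?_⟩ <;> omega

lemma pairStart_mono (n m : ℕ) {t t' : ℕ} (h : t ≤ t') (hle : tailStart n m ≤ mate n m)
    (hev : (mate n m - tailStart n m) % 2 = 0) :
    pairStart n m t + 2 * (t' - t) ≤ pairStart n m t' := by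
  have : m < tailStart n m := by simp only [tailStart]; omega
  simp only [pairStart]
  split_ifs <;> omega

lemma pairStart_pos (n m t : ℕ) : 0 < pairStart n m t := by
  have : m < tailStart n m := by simp only [tailStart]; omega
  simp only [pairStart]
  split_ifs <;> omega

lemma pairStart_le (hn : 12 ≤ n) (hm : 2 ≤ m) {t : ℕ} (ht : t + 3 ≤ m * n) :
    pairStart n m t + 2 * (m * n - 3 - t) + 2 ≤ maxLen n m := by
  obtain ⟨h1, h2, h3, -⟩ := mate_spec hn hm
  have key : pairStart n m (m * n - 3) + 2 ≤ maxLen n m := by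
    obtain ⟨h4, h5, -⟩ := mul_bounds hn hm
    simp only [pairStart]
    have h6 : tailStart n m + m % 2 = m + 3 * n + 3 := by simp only [tailStart]; omega
    have h7 : maxLen n m = 2 * (m * n) + 3 * n := rfl
    generalize m * n = q at *
    split_ifs <;> omega
  have := pairStart_mono n m (t := t) (t' := m * n - 3) (by omega) h1 h3
  omega

lemma le_pairStart {t : ℕ} (ht : m / 2 < t) (hle : tailStart n m ≤ mate n m)
    (hev : (mate n m - tailStart n m) % 2 = 0) :
    m + 3 * n + 4 ≤ pairStart n m t := by
  simp only [pairStart]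
  have h6 : tailStart n m + m % 2 = m + 3 * n + 3 := by simp only [tailStart]; omega
  split_ifs <;> omega

lemma pairOf_mono (hn : 12 ≤ n) (hm : 2 ≤ m) {i j j' : ℕ} (hj : j ≤ j') (hj' : j' < m) :
    pairOf n m i j' + 2 * (j' - j) ≤ pairOf n m i j := by
  obtain ⟨h1, -, h3, -⟩ := mate_spec hn hm
  rcases Nat.eq_zero_or_pos i with rfl | hi
  · have := pairStart_mono n m (t := m - 1 - j') (t' := m - 1 - j) (by omega) h1 h3
    simp only [pairOf, if_pos]
    omega
  · have him : m ≤ i * m := Nat.le_mul_of_pos_left m hi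
    have := pairStart_mono n m (t := i * m + m - 3 - j') (t' := i * m + m - 3 - j)
      (by omega) h1 h3
    simp only [pairOf, if_neg hi.ne']
    omega

lemma mul_add_le {i : ℕ} (hi : i < n) : i * m + m ≤ m * n := by
  rw [← Nat.succ_mul, mul_comm m n]
  exact Nat.mul_le_mul_right m hi

lemma pairOf_le (hn : 12 ≤ n) (hm : 2 ≤ m) {i j : ℕ} (hi : i < n) (hj : j < m)
    (h0 : i = 0 → 2 ≤ j) :
    pairOf n m i j + j + 2 ≤ maxLen n m ∧ (i = 0 → pairOf n m i j + j + 3 ≤ maxLen n m) := by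
  obtain ⟨h4, h5, -⟩ := mul_bounds hn hm
  rcases Nat.eq_zero_or_pos i with rfl | hi'
  · have := pairStart_le hn hm (t := m - 1 - j) (by omega)
    simp only [pairOf, if_pos]
    have := h0 rfl
    omega
  · have him : m ≤ i * m := Nat.le_mul_of_pos_left m hi'
    have := mul_add_le (m := m) hi
    have := pairStart_le hn hm (t := i * m + m - 3 - j) (by omega)
    simp only [pairOf, if_neg hi'.ne']
    omega

lemma le_pairOf (hn : 12 ≤ n) (hm : 2 ≤ m) {i j : ℕ} (hi : 2 ≤ i) (hj : j < 2) :
    m + 3 * n + 4 ≤ pairOf n m i j := by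
  obtain ⟨h1, -, h3, -⟩ := mate_spec hn hm
  have him : 2 * m ≤ i * m := Nat.mul_le_mul_right m hi
  simp only [pairOf, if_neg (show i ≠ 0 by omega)]
  exact le_pairStart (by omega) h1 h3

lemma legB_bounds {i : ℕ} (hi : i < n) :
    m + n < legB n m i ∧ legB n m i + i + 1 ≤ m + 3 * n + 1 := by
  simp only [legB, hole]
  split_ifs <;> omega

variable {s : ℕ → ℕ → Bool} {i u : ℕ}

lemma vertex_even {j : ℕ} (hj : j ≤ m) (h0 : i = 0 → j ≠ 1) : vertex n m s i (2 * j) = j := by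
  simp only [vertex]
  rw [if_neg (by omega), if_neg (by omega), if_neg (by omega), if_neg (by omega),
    if_neg (by omega), if_neg (by omega), if_pos (by omega)]
  congr 1
  omega

lemma vertex_odd {j : ℕ} (hj : j < m) (h0 : i = 0 → 2 ≤ j) :
    vertex n m s i (2 * j + 1) =
      if s i j then (j : ℤ) + pairOf n m i j + 1 else (j : ℤ) - pairOf n m i j := by
  simp only [vertex]
  rw [if_neg (by omega), if_neg (by omega), if_neg (by omega), if_neg (by omega),
    if_neg (by omega), if_neg (by omega), if_neg (by omega),
    show (2 * j + 1) / 2 = j by omega]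

lemma vertex_last : vertex n m s i (2 * m + 3) = 0 := by simp [vertex]

lemma vertex_legC : vertex n m s i (2 * m + 2) = -(legB n m i + i + 1) := by simp [vertex]

lemma vertex_legB : vertex n m s i (2 * m + 1) = -(i + 1) := by simp [vertex]

lemma vertex_one (hm : 2 ≤ m) : vertex n m s 0 1 = -apex n m := by
  rw [vertex]
  rw [if_neg (by omega), if_neg (by omega), if_neg (by omega), if_pos ⟨rfl, rfl⟩]

lemma vertex_two (hm : 2 ≤ m) : vertex n m s 0 2 = -apex n m + holeHi n m := by
  rw [vertex]
  rw [if_neg (by omega), if_neg (by omega), if_neg (by omega), if_neg (by omega),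
    if_pos ⟨rfl, rfl⟩]

lemma vertex_three (hm : 2 ≤ m) : vertex n m s 0 3 = -apex n m + holeHi n m - holeLo n m := by
  rw [vertex]
  rw [if_neg (by omega), if_neg (by omega), if_neg (by omega), if_neg (by omega),
    if_neg (by omega), if_pos ⟨rfl, rfl⟩]

lemma vertex_cases (hn : 12 ≤ n) (hm : 2 ≤ m) (hs : ∀ i j, s i j = false → 2 ≤ i ∧ j < 2)
    (hi : i < n) (hu : u < 2 * m + 3) :
    (∃ j ≤ m, u = 2 * j ∧ vertex n m s i u = j) ∨
    (∃ j < m, u = 2 * j + 1 ∧ vertex n m s i u = j + pairOf n m i j + 1 ∧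
      m < j + pairOf n m i j + 1 ∧
      pairOf n m i j + j + 2 ≤ maxLen n m ∧ (i = 0 → pairOf n m i j + j + 3 ≤ maxLen n m)) ∨
    (∃ j < 2, u = 2 * j + 1 ∧ vertex n m s i u = j - pairOf n m i j ∧
      m + 3 * n + 4 ≤ pairOf n m i j ∧ i ≠ 0 ∧ pairOf n m i j + j + 2 ≤ maxLen n m) ∨
    (u = 2 * m + 1 ∧ vertex n m s i u = -(i + 1)) ∨
    (u = 2 * m + 2 ∧ vertex n m s i u = -(legB n m i + i + 1)) ∨
    (i = 0 ∧ u = 1 ∧ vertex n m s i u = -apex n m) ∨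
    (i = 0 ∧ u = 2 ∧ vertex n m s i u = -apex n m + holeHi n m) ∨
    (i = 0 ∧ u = 3 ∧ vertex n m s i u = -apex n m + holeHi n m - holeLo n m) := by
  by_cases h1 : u = 2 * m + 1
  · subst h1; exact Or.inr (Or.inr (Or.inr (Or.inl ⟨rfl, vertex_legB⟩)))
  by_cases h2 : u = 2 * m + 2
  · subst h2; exact Or.inr (Or.inr (Or.inr (Or.inr (Or.inl ⟨rfl, vertex_legC⟩))))
  by_cases h3 : i = 0 ∧ u = 1
  · obtain ⟨rfl, rfl⟩ := h3
    exact Or.inr (Or.inr (Or.inr (Or.inr (Or.inr (Or.inl ⟨rfl, rfl, vertex_one hm⟩)))))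
  by_cases h4 : i = 0 ∧ u = 2
  · obtain ⟨rfl, rfl⟩ := h4
    exact Or.inr (Or.inr (Or.inr (Or.inr (Or.inr (Or.inr (Or.inl ⟨rfl, rfl, vertex_two hm⟩))))))
  by_cases h5 : i = 0 ∧ u = 3
  · obtain ⟨rfl, rfl⟩ := h5
    exact Or.inr (Or.inr (Or.inr (Or.inr (Or.inr (Or.inr (Or.inr
      ⟨rfl, rfl, vertex_three hm⟩))))))
  rcases Nat.even_or_odd' u with ⟨j, rfl | rfl⟩
  · exact Or.inl ⟨j, by omega, rfl, vertex_even (by omega) (by omega)⟩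
  · have hj : j < m := by omega
    have h0 : i = 0 → 2 ≤ j := by omega
    have hle := pairOf_le hn hm hi hj h0
    cases hsj : s i j with
    | true =>
      have hmono := pairOf_mono (i := i) hn hm (show j ≤ m - 1 by omega) (by omega)
      have hpos : 0 < pairOf n m i (m - 1) := pairStart_pos _ _ _
      refine Or.inr (Or.inl ⟨j, hj, rfl, ?_, by omega, hle⟩)
      rw [vertex_odd hj h0, if_pos hsj]
    | false =>
      obtain ⟨hi2, hj2⟩ := hs i j hsj
      refine Or.inr (Or.inr (Or.inl ⟨j, hj2, rfl, ?_, le_pairOf hn hm hi2 hj2, by omega, hle.1⟩))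
      rw [vertex_odd hj h0, hsj]
      rfl

lemma vertex_injOn (hn : 12 ≤ n) (hm : 2 ≤ m) (hs : ∀ i j, s i j = false → 2 ≤ i ∧ j < 2)
    (hi : i < n) {u' : ℕ} (hu : u < u') (hu' : u' < 2 * m + 3) :
    vertex n m s i u ≠ vertex n m s i u' ∧
      |vertex n m s i u - vertex n m s i u'| < 2 * maxLen n m + 1 := by
  have hb := legB_bounds (m := m) hi
  have hm' := mate_spec hn hm
  have hq := mul_bounds hn hm
  have hL : maxLen n m = 2 * (m * n) + 3 * n := rfl
  have hH : holeHi n m ≤ m + 3 * n + 2 := by simp only [holeHi, hole]; split_ifs <;> omega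
  rw [abs_lt]
  rcases vertex_cases hn hm hs hi (hu.trans hu') with ⟨j, hj, h1, h2⟩ | ⟨j, hj, h1, h2, h3⟩ |
      ⟨j, hj, h1, h2, h3⟩ | ⟨h1, h2⟩ | ⟨h1, h2⟩ | ⟨h0, h1, h2⟩ | ⟨h0, h1, h2⟩ | ⟨h0, h1, h2⟩ <;>
    rcases vertex_cases hn hm hs hi hu' with ⟨j', hj', h1', h2'⟩ | ⟨j', hj', h1', h2', h3'⟩ |
      ⟨j', hj', h1', h2', h3'⟩ | ⟨h1', h2'⟩ | ⟨h1', h2'⟩ | ⟨h0', h1', h2'⟩ | ⟨h0', h1', h2'⟩ |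
      ⟨h0', h1', h2'⟩ <;>
    rw [h2, h2']
  case inr.inl.inr.inl =>
    have := pairOf_mono (i := i) hn hm (show j ≤ j' by omega) (by omega)
    omega
  case inr.inr.inl.inr.inr.inl =>
    have := pairOf_mono (i := i) hn hm (show j ≤ j' by omega) (by omega)
    omega
  all_goals omega

end Construction

end CCS

namespace CCS

section Construction

variable {n m : ℕ} {s : ℕ → ℕ → Bool}

lemma exists_pairOf_eq {t : ℕ} (hm : 2 ≤ m) (ht : t + 2 < m * n) :
    ∃ i < n, ∃ j < m, (i = 0 → 2 ≤ j) ∧ pairOf n m i j = pairStart n m t := by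
  by_cases h : t + 2 < m
  · have : 0 < n := Nat.pos_of_ne_zero (by rintro rfl; omega)
    refine ⟨0, this, m - 1 - t, by omega, by omega, ?_⟩
    rw [pairOf, if_pos rfl]
    congr 1
    omega
  · have hdiv := Nat.div_add_mod (t + 2) m
    have hmod := Nat.mod_lt (t + 2) (show m > 0 by omega)
    have hpos : 0 < (t + 2) / m := Nat.div_pos (by omega) (by omega)
    refine ⟨(t + 2) / m, Nat.div_lt_of_lt_mul ht, m - 1 - (t + 2) % m, by omega, by omega, ?_⟩
    rw [pairOf, if_neg hpos.ne', mul_comm]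
    congr 1
    omega

lemma exists_pairStart_eq (hn : 12 ≤ n) (hm : 2 ≤ m) {d : ℕ} (hd : 0 < d) (hd' : d < maxLen n m)
    (hmate : d ≠ mate n m) (h : d ≤ m - m % 2 ∨ tailStart n m ≤ d) :
    ∃ t, t + 2 < m * n ∧ (d = pairStart n m t ∨ d = pairStart n m t + 1) := by
  obtain ⟨h1, h2, h3, -⟩ := mate_spec hn hm
  obtain ⟨h4, h5, -⟩ := mul_bounds hn hm
  have h6 : tailStart n m + m % 2 = m + 3 * n + 3 := by simp only [tailStart]; omega
  have h7 : maxLen n m = 2 * (m * n) + 3 * n := rfl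
  simp only [pairStart]
  generalize m * n = q at *
  by_cases c1 : d ≤ m - m % 2
  · refine ⟨(d - 1) / 2, by omega, ?_⟩
    split_ifs <;> omega
  by_cases c2 : d < mate n m
  · refine ⟨m / 2 + (d - tailStart n m) / 2, by omega, ?_⟩
    split_ifs <;> omega
  · refine ⟨m / 2 + (mate n m - tailStart n m) / 2 + (d - mate n m - 1) / 2, by omega, ?_⟩
    split_ifs <;> omega

lemma exists_legB_eq {d : ℕ} (hd : m + n < d) (hd' : d ≤ m + 3 * n + 1) (hh : d ≠ hole n m) :
    ∃ i < n, d = legB n m i ∨ d = legB n m i + i + 1 := by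
  simp only [legB]
  simp only [hole] at *
  by_cases c1 : d < m + n + (n + 1) / 2 + 1
  · refine ⟨2 * (m + n + (n + 1) / 2 + 1 - d) - 2, by omega, ?_⟩
    split_ifs <;> omega
  by_cases c2 : d ≤ m + n + 2 * ((n + 1) / 2)
  · refine ⟨2 * (d - (m + n + (n + 1) / 2 + 1)), by omega, ?_⟩
    split_ifs <;> omega
  by_cases c3 : d < m + 2 * n + (n + 1) / 2 + 1
  · refine ⟨2 * (m + 2 * n + (n + 1) / 2 + 1 - d) - 1, by omega, ?_⟩
    split_ifs <;> omega
  · refine ⟨2 * (d - (m + 2 * n + (n + 1) / 2 + 1)) - 1, by omega, ?_⟩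
    split_ifs <;> omega

lemma exists_vertex_diff_of_pair (hn : 12 ≤ n) (hm : 2 ≤ m) (s : ℕ → ℕ → Bool) {d : ℕ}
    (hd : 0 < d) (hd' : d < maxLen n m) (hmate : d ≠ mate n m)
    (hrange : d ≤ m - m % 2 ∨ tailStart n m ≤ d) :
    ∃ i < n, ∃ u < 2 * m + 3,
      vertex n m s i (u + 1) - vertex n m s i u = d ∨
      vertex n m s i (u + 1) - vertex n m s i u = -d := by
  obtain ⟨t, ht, hdt⟩ := exists_pairStart_eq hn hm hd hd' hmate hrange
  obtain ⟨i, hi, j, hj, h0, hij⟩ := exists_pairOf_eq hm ht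
  have e0 := vertex_even (n := n) (s := s) (i := i) hj.le (by omega)
  have e1 := vertex_odd (n := n) (s := s) hj h0
  have e2 := vertex_even (n := n) (s := s) (i := i) (j := j + 1) hj (by omega)
  rw [show 2 * (j + 1) = 2 * j + 1 + 1 by ring] at e2
  have hor : (vertex n m s i (2 * j + 1) - vertex n m s i (2 * j) = d ∨
      vertex n m s i (2 * j + 1) - vertex n m s i (2 * j) = -d) ∨
      (vertex n m s i (2 * j + 1 + 1) - vertex n m s i (2 * j + 1) = d ∨
      vertex n m s i (2 * j + 1 + 1) - vertex n m s i (2 * j + 1) = -d) := by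
    rw [e0, e1, e2]
    split_ifs <;> omega
  rcases hor with h | h
  · exact ⟨i, hi, 2 * j, by omega, h⟩
  · exact ⟨i, hi, 2 * j + 1, by omega, h⟩

lemma exists_vertex_diff (hn : 12 ≤ n) (hm : 2 ≤ m) (s : ℕ → ℕ → Bool) {d : ℕ} (hd : 0 < d)
    (hd' : d ≤ maxLen n m) :
    ∃ i < n, ∃ u < 2 * m + 3,
      vertex n m s i (u + 1) - vertex n m s i u = d ∨
      vertex n m s i (u + 1) - vertex n m s i u = -d ∨
      vertex n m s i (u + 1) - vertex n m s i u = d - (2 * maxLen n m + 1) := by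
  obtain ⟨h1, h2, -, h3, h4, -⟩ := mate_spec hn hm
  have v0 : vertex n m s 0 0 = 0 := by
    simpa using vertex_even (n := n) (s := s) (i := 0) (j := 0) (Nat.zero_le m) (by simp)
  have v4 : vertex n m s 0 4 = 2 := by
    simpa using vertex_even (n := n) (s := s) (i := 0) (j := 2) hm (by simp)
  have v1 := vertex_one (n := n) (s := s) hm
  have v2 := vertex_two (n := n) (s := s) hm
  have v3 := vertex_three (n := n) (s := s) hm
  by_cases cmax : d = maxLen n m
  · refine ⟨0, by omega, 0, by omega, ?_⟩
    rw [zero_add, v0, v1]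
    omega
  by_cases chi : d = holeHi n m
  · refine ⟨0, by omega, 1, by omega, Or.inl ?_⟩
    rw [v1, v2]
    omega
  by_cases clo : d = holeLo n m
  · refine ⟨0, by omega, 2, by omega, Or.inr (Or.inl ?_)⟩
    rw [v2, v3]
    omega
  by_cases cmate : d = mate n m
  · refine ⟨0, by omega, 3, by omega, Or.inl ?_⟩
    rw [v3, v4]
    omega
  by_cases cA : m < d ∧ d ≤ m + n
  · refine ⟨d - m - 1, by omega, 2 * m, by omega, Or.inr (Or.inl ?_)⟩
    rw [vertex_legB, vertex_even le_rfl (by omega)]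
    omega
  by_cases cB : m + n < d ∧ d ≤ m + 3 * n + 1
  · have hh : d ≠ hole n m := by
      intro hh
      simp only [holeHi, holeLo] at chi clo
      split_ifs at chi clo <;> omega
    obtain ⟨i, hi, h | h⟩ := exists_legB_eq cB.1 cB.2 hh
    · refine ⟨i, hi, 2 * m + 1, by omega, Or.inr (Or.inl ?_)⟩
      rw [vertex_legC, vertex_legB]
      omega
    · refine ⟨i, hi, 2 * m + 2, by omega, Or.inl ?_⟩
      rw [vertex_last, vertex_legC]
      omega
  have hrange : d ≤ m - m % 2 ∨ tailStart n m ≤ d := by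
    simp only [tailStart]
    simp only [holeHi, holeLo] at chi clo
    split_ifs at chi clo <;> omega
  obtain ⟨i, hi, u, hu, h⟩ :=
    exists_vertex_diff_of_pair hn hm s hd (by omega) cmate hrange
  exact ⟨i, hi, u, hu, h.imp_right Or.inl⟩

/-- The vertices of the base cycles modulo `v`. -/
def baseCycle (v n m : ℕ) (s : ℕ → ℕ → Bool) (i : Fin n) (u : Fin (2 * m + 3)) : ZMod v :=
  (vertex n m s i u : ℤ)

variable {v : ℕ}

lemma baseCycle_nextIdx (i : Fin n) (u : Fin (2 * m + 3)) :
    baseCycle v n m s i (nextIdx u) = (vertex n m s i (u + 1) : ℤ) := by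
  have hu := u.2
  rw [baseCycle, nextIdx]
  rcases Nat.lt_or_ge (u.1 + 1) (2 * m + 3) with h | h
  · simp only [Nat.mod_eq_of_lt h]
  · have hu' : u.1 + 1 = 2 * m + 3 := by omega
    simp only [hu', Nat.mod_self, vertex_last]
    have := vertex_even (n := n) (s := s) (i := i) (j := 0) (Nat.zero_le m) (by simp)
    rw [mul_zero] at this
    rw [this]
    simp

lemma intCast_ne_of_abs_sub_lt {a b : ℤ} (hab : a ≠ b) (h : |a - b| < v) :
    (a : ZMod v) ≠ b := by
  intro he
  rw [ZMod.intCast_eq_intCast_iff_dvd_sub, ← dvd_neg, neg_sub] at he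
  exact hab (sub_eq_zero.1 (Int.eq_zero_of_abs_lt_dvd he h))

lemma baseCycle_isBaseFamily (hv : v = 2 * maxLen n m + 1) (hn : 12 ≤ n) (hm : 2 ≤ m)
    (hs : ∀ i j, s i j = false → 2 ≤ i ∧ j < 2) : IsBaseFamily (baseCycle v n m s) where
  inj i := by
    have key : ∀ a b : Fin (2 * m + 3), a < b → baseCycle v n m s i a ≠ baseCycle v n m s i b :=
      fun a b h => by
        obtain ⟨h1, h2⟩ := vertex_injOn hn hm hs i.2 h b.2
        exact intCast_ne_of_abs_sub_lt h1 (by rw [hv]; exact_mod_cast h2)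
    intro a b hab
    rcases lt_trichotomy a b with h | h | h
    · exact absurd hab (key a b h)
    · exact h
    · exact absurd hab.symm (key b a h)
  cover d hd := by
    have : NeZero v := ⟨by omega⟩
    have hv0 : ((2 * maxLen n m + 1 : ℤ) : ZMod v) = 0 := by
      have := ZMod.natCast_self v
      rw [hv] at this ⊢
      exact_mod_cast this
    have main : ∀ e : ℕ, 0 < e → e ≤ maxLen n m → ∃ i u,
        diffAt (baseCycle v n m s i) u = e ∨ diffAt (baseCycle v n m s i) u = -e := by
      intro e he he'
      obtain ⟨i, hi, u, hu, h⟩ := exists_vertex_diff hn hm s he he'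
      refine ⟨⟨i, hi⟩, ⟨u, hu⟩, ?_⟩
      rw [diffAt, baseCycle_nextIdx, baseCycle]
      rcases h with h | h | h <;> have h := congrArg (Int.cast : ℤ → ZMod v) h
      · left; exact_mod_cast h
      · right
        push_cast at h ⊢
        exact h
      · left
        rw [Int.cast_sub, Int.cast_sub, hv0, sub_zero] at h
        exact_mod_cast h
    have hlt := ZMod.val_lt d
    have hpos : 0 < d.val := Nat.pos_of_ne_zero fun h => hd ((ZMod.val_eq_zero d).1 h)
    by_cases hle : d.val ≤ maxLen n m
    · simpa using main d.val hpos hle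
    · obtain ⟨i, u, h⟩ := main (v - d.val) (by omega) (by omega)
      rw [Nat.cast_sub hlt.le, ZMod.natCast_self, ZMod.natCast_zmod_val, zero_sub, neg_neg] at h
      exact ⟨i, u, h.symm⟩

lemma not_development_eq {s' : ℕ → ℕ → Bool} (hv : v = 2 * maxLen n m + 1) (hn : 12 ≤ n)
    (hm : 2 ≤ m) (hs : ∀ i j, s i j = false → 2 ≤ i ∧ j < 2)
    (hs' : ∀ i j, s' i j = false → 2 ≤ i ∧ j < 2) {i j : ℕ} (hi : i < n)
    (h1 : s i j = true) (h2 : s' i j = false) :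
    development (baseCycle v n m s) ≠ development (baseCycle v n m s') := by
  intro h
  obtain ⟨hi2, hj2⟩ := hs' i j h2
  have hv' : v = 2 * n * (2 * m + 3) + 1 := by rw [hv, maxLen]; ring
  have B := baseCycle_isBaseFamily hv hn hm hs
  have B' := baseCycle_isBaseFamily hv hn hm hs'
  have hne : (⟨2 * m + 2, by omega⟩ : Fin (2 * m + 3)) ≠ nextIdx ⟨2 * m + 2, by omega⟩ := by
    simp [nextIdx]
  have hE := IsBaseFamily.edgesOf_eq_of_development_eq (C := baseCycle v n m s) B' hv' h
    (i := ⟨i, hi⟩) (u := ⟨2 * m + 2, by omega⟩)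
    (by simp only [baseCycle, vertex_legC])
    (by simp only [baseCycle_nextIdx, vertex_last])
    (fun he => hne (B.inj _ he))
  have e0 : ∀ s, vertex n m s i (2 * j) = j := fun s => vertex_even (by omega) (by omega)
  have e1 := vertex_odd (n := n) (m := m) (s := s) (i := i) (j := j) (by omega) (by omega)
  have e1' := vertex_odd (n := n) (m := m) (s := s') (i := i) (j := j) (by omega) (by omega)
  have e2 : ∀ s, vertex n m s i (2 * j + 1 + 1) = j + 1 := fun s => by
    have := vertex_even (n := n) (m := m) (s := s) (i := i) (j := j + 1) (by omega) (by omega)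
    rw [show 2 * j + 1 + 1 = 2 * (j + 1) by ring, this]
    push_cast
    ring
  rw [h1, if_pos rfl] at e1
  rw [h2, if_neg (by simp)] at e1'
  have hedge := B'.edgeAt_eq_of_edgesOf_eq hv' hE (u := ⟨2 * j, by omega⟩)
    (u' := ⟨2 * j + 1, by omega⟩) (Or.inl (by
      simp only [diffAt, baseCycle_nextIdx]
      simp only [baseCycle, e0, e1, e1', e2]
      push_cast
      ring))
  simp only [edgeAt, baseCycle_nextIdx] at hedge
  simp only [baseCycle, e0, e1', e2] at hedge
  have hle := pairOf_le hn hm hi (show j < m by omega) (by omega)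
  have hge := le_pairOf hn hm hi2 hj2
  have n1 : ((j : ℤ) : ZMod v) ≠ ((j - pairOf n m i j : ℤ) : ZMod v) :=
    intCast_ne_of_abs_sub_lt (by omega) (by rw [abs_lt]; omega)
  have n2 : ((j : ℤ) : ZMod v) ≠ ((j + 1 : ℤ) : ZMod v) :=
    intCast_ne_of_abs_sub_lt (by omega) (by rw [abs_lt]; omega)
  rcases Sym2.eq_iff.1 hedge with ⟨h, -⟩ | ⟨h, -⟩
  · exact n1 h
  · exact n2 h

/-- The sign pattern with prescribed signs for the first two pairs of the `i`-th cycle,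
`2 ≤ i < n`, and all other signs positive. -/
def signs (n : ℕ) (ω : Fin (n - 2) × Fin 2 → Bool) (i j : ℕ) : Bool :=
  if h : (2 ≤ i ∧ i < n) ∧ j < 2 then ω (⟨i - 2, by omega⟩, ⟨j, h.2⟩) else true

lemma signs_eq_false {ω : Fin (n - 2) × Fin 2 → Bool} {i j : ℕ} (h : signs n ω i j = false) :
    2 ≤ i ∧ j < 2 := by
  unfold signs at h
  split_ifs at h with h'
  exact ⟨h'.1.1, h'.2⟩

lemma signs_apply (ω : Fin (n - 2) × Fin 2 → Bool) (x : Fin (n - 2) × Fin 2) :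
    signs n ω (x.1 + 2) x.2 = ω x := by
  have h1 := x.1.2
  have h2 := x.2.2
  rw [signs, dif_pos (by omega)]
  congr 1

lemma four_pow_le_card (hn : 12 ≤ n) (hm : 2 ≤ m) (hv : v = 2 * n * (2 * m + 3) + 1) :
    4 ^ (n - 2) ≤ Nat.card {B : Set (Block v) // IsCyclicDesign v (2 * m + 3) B} := by
  have : NeZero v := ⟨by omega⟩
  have hv' : v = 2 * maxLen n m + 1 := by rw [hv, maxLen]; ring
  let Φ : (Fin (n - 2) × Fin 2 → Bool) →
      {B : Set (Block v) // IsCyclicDesign v (2 * m + 3) B} := fun ω =>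
    ⟨development (baseCycle v n m (signs n ω)),
      (baseCycle_isBaseFamily hv' hn hm fun _ _ => signs_eq_false).isCyclicDesign hv⟩
  have hΦ : Function.Injective Φ := by
    intro ω ω' h
    have h := congrArg Subtype.val h
    funext x
    have hx : x.1 + 2 < n := by have := x.1.2; omega
    rw [← signs_apply ω x, ← signs_apply ω' x]
    cases h1 : signs n ω (x.1 + 2) x.2 <;> cases h2 : signs n ω' (x.1 + 2) x.2
    · rfl
    · exact absurd h.symm (not_development_eq hv' hn hm (fun _ _ => signs_eq_false)
        (fun _ _ => signs_eq_false) hx h2 h1)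
    · exact absurd h (not_development_eq hv' hn hm (fun _ _ => signs_eq_false)
        (fun _ _ => signs_eq_false) hx h1 h2)
    · rfl
  have := Nat.card_le_card_of_injective Φ hΦ
  refine le_trans (le_of_eq ?_) this
  rw [Nat.card_eq_fintype_card, Fintype.card_fun, Fintype.card_prod, Fintype.card_fin,
    Fintype.card_fin, Fintype.card_bool, mul_comm, pow_mul]
  norm_num

end Construction

lemma exists_forall_pow_le : ∃ N : ℕ, ∀ n : ℕ, N ≤ n →
    (2 * n + 1 : ℝ) * 3.35 ^ n * 16 ≤ 4 ^ n := by
  have h := tendsto_self_mul_const_pow_of_lt_one (r := (3.35 / 4 : ℝ)) (by norm_num) (by norm_num)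
  have h2 := h.eventually (gt_mem_nhds (show (0 : ℝ) < 1 / 48 by norm_num))
  obtain ⟨N, hN⟩ := Filter.eventually_atTop.1 h2
  refine ⟨max N 1, fun n hn => ?_⟩
  have h3 := hN n (le_trans (le_max_left _ _) hn)
  have h1 : (1 : ℝ) ≤ n := by exact_mod_cast le_trans (le_max_right _ _) hn
  have h4 : (0 : ℝ) < 4 ^ n := by positivity
  have h5 : (0 : ℝ) < 3.35 ^ n := by positivity
  rw [div_pow, ← mul_div_assoc, div_lt_iff₀ h4] at h3
  nlinarith

end CCS

/-- There is `N` such that for every odd `k > 5` and every `n ≥ N`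
with `n ≡ 4 (mod 7)`, `NC(2nk+1, k) ≥ 3.35^n / k`. -/
theorem stmt14 : ∃ N : ℕ, ∀ k n : ℕ, Odd k → 5 < k → N ≤ n → n % 7 = 4 →
    (3.35 : ℝ) ^ n / (k : ℝ) ≤ (CCS.NC (2 * n * k + 1) k : ℝ) := by
  obtain ⟨N, hN⟩ := CCS.exists_forall_pow_le
  refine ⟨max N 12, fun k n hk hk5 hn _ => ?_⟩
  obtain ⟨m, rfl⟩ : ∃ m, k = 2 * m + 3 := by
    obtain ⟨r, rfl⟩ := hk
    exact ⟨r - 1, by omega⟩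
  have hn12 : 12 ≤ n := le_trans (le_max_right _ _) hn
  have hNn := hN n (le_trans (le_max_left _ _) hn)
  have hcount := (CCS.four_pow_le_card (m := m) hn12 (by omega) rfl).trans
    (CCS.card_cyclicDesign_le (2 * n * (2 * m + 3) + 1) (2 * m + 3))
  set X := CCS.NC (2 * n * (2 * m + 3) + 1) (2 * m + 3)
  have hk : (0 : ℝ) < ((2 * m + 3 : ℕ) : ℝ) := by positivity
  have hk1 : (1 : ℝ) ≤ ((2 * m + 3 : ℕ) : ℝ) := by exact_mod_cast (by omega : 1 ≤ 2 * m + 3)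
  have hcount' : (4 : ℝ) ^ (n - 2) ≤ (2 * n * ((2 * m + 3 : ℕ) : ℝ) + 1) * X := by
    exact_mod_cast hcount
  have hpow : (4 : ℝ) ^ n = 4 ^ (n - 2) * 16 := by
    rw [show (16 : ℝ) = 4 ^ 2 by norm_num, ← pow_add, Nat.sub_add_cancel (by omega)]
  have hX : (0 : ℝ) ≤ X := Nat.cast_nonneg _
  rw [div_le_iff₀ hk]
  refine le_of_mul_le_mul_left (a := (2 * n + 1 : ℝ)) ?_ (by positivity)
  nlinarith [mul_le_mul_of_nonneg_right hk1 hX]
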